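/- Let G be a gyrogroup. Then the left nucleus N_l(G), the middle nucleus N_m(G), and the right nucleus N_r(G) are L-subgyrogroups of G; furthermore, each of them is a subgroup of G (i.e., forms a group under ⊕). -/

import Mathlib

universe u v

/-- A gyrogroup: a groupoid `(G, +)` with a left identity `0`, left inverses `-a`,
gyroautomorphisms `gyr a b` (automorphisms of `(G, +)`) satisfying the left
gyroassociative law, and the left loop property. -/
class Gyrogroup (G : Type u) extends Add G, Zero G, Neg G where
  /-- (G1) left identity -/
  zero_add' : ∀ a : G, 0 + a = a
  /-- (G2) left inverse -/
  neg_add' : ∀ a : G, -a + a = 0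
  /-- (G3) the gyroautomorphisms, as bijections of `G` -/
  gyr : G → G → G ≃ G
  /-- (G3) each `gyr a b` preserves the operation, i.e. is an automorphism -/
  gyr_add' : ∀ a b x y : G, gyr a b (x + y) = gyr a b x + gyr a b y
  /-- (G3) left gyroassociative law -/
  add_gyr_assoc' : ∀ a b c : G, a + (b + c) = (a + b) + gyr a b c
  /-- (G4) left loop property -/
  left_loop' : ∀ a b : G, gyr (a + b) b = gyr a b

open Gyrogroup

variable {G : Type u}

/-- A subgyrogroup: a nonempty subset closed under the operation and inverses. -/
structure IsSubgyrogroup [Gyrogroup G] (H : Set G) : Prop where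
  nonempty : H.Nonempty
  add_mem : ∀ ⦃a : G⦄, a ∈ H → ∀ ⦃b : G⦄, b ∈ H → a + b ∈ H
  neg_mem : ∀ ⦃a : G⦄, a ∈ H → -a ∈ H

/-- A gyrogroup homomorphism: a map preserving the operation. -/
def IsGyroHom [Gyrogroup G] {A : Type v} [Gyrogroup A] (φ : G → A) : Prop :=
  ∀ x y : G, φ (x + y) = φ x + φ y

/-- The kernel of a map into a gyrogroup. -/
def gyroKer [Gyrogroup G] {A : Type v} [Gyrogroup A] (φ : G → A) : Set G :=
  {x : G | φ x = 0}

/-- A normal subgyrogroup: the kernel of some gyrogroup homomorphism from `G`. -/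
def IsNormalSubgyrogroup [Gyrogroup G] (N : Set G) : Prop :=
  IsSubgyrogroup N ∧ ∃ (A : Type u) (instA : Gyrogroup A) (φ : G → A),
    @IsGyroHom G _ A instA φ ∧ N = @gyroKer G _ A instA φ

/-- The gyrocommutator `[a, b] = -(a + b) + gyr a b (b + a)`. -/
def gyroCommutator [Gyrogroup G] (a b : G) : G :=
  -(a + b) + gyr a b (b + a)

/-- The set of all gyrocommutators of `G`. -/
def gyroCommutatorSet (G : Type u) [Gyrogroup G] : Set G :=
  {x : G | ∃ a b : G, x = gyroCommutator a b}

/-- `K` is the commutator subgyrogroup `G'` of `G`: the smallest subgyrogroup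
containing all commutators. -/
def IsCommutatorSubgyrogroup [Gyrogroup G] (K : Set G) : Prop :=
  IsSubgyrogroup K ∧ gyroCommutatorSet G ⊆ K ∧
    ∀ H : Set G, IsSubgyrogroup H → gyroCommutatorSet G ⊆ H → K ⊆ H

/-- `K` is the normal closure `⟨⟨A⟩⟩` of `A`: the smallest normal subgyrogroup
containing `A`. -/
def IsGyroNormalClosure [Gyrogroup G] (A K : Set G) : Prop :=
  IsNormalSubgyrogroup K ∧ A ⊆ K ∧
    ∀ N : Set G, IsNormalSubgyrogroup N → A ⊆ N → K ⊆ N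

/-- The left coset `a ⊕ H`. -/
def lcoset [Gyrogroup G] (a : G) (H : Set G) : Set G := (a + ·) '' H

/-- The right coset `H ⊕ a`. -/
def rcoset [Gyrogroup G] (H : Set G) (a : G) : Set G := (· + a) '' H

/-- A gyrogroup is gyrocommutative if `a + b = gyr a b (b + a)` for all `a, b`. -/
def IsGyrocommutative (G : Type u) [Gyrogroup G] : Prop :=
  ∀ a b : G, a + b = gyr a b (b + a)

/-- An L-subgyrogroup: a subgyrogroup with `gyr a h (H) = H` for all `a ∈ G`, `h ∈ H`. -/
def IsLSubgyrogroup [Gyrogroup G] (H : Set G) : Prop :=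
  IsSubgyrogroup H ∧ ∀ a : G, ∀ h ∈ H, ⇑(gyr a h) '' H = H

/-- A subgroup of a gyrogroup: a subgyrogroup that forms a group under the gyrogroup
operation (equivalently, on which the operation is associative; together with the
closure properties and the identity and inverses inherited from `G`, this makes it
a group). -/
def IsSubgroupOfGyrogroup [Gyrogroup G] (H : Set G) : Prop :=
  IsSubgyrogroup H ∧ ∀ a ∈ H, ∀ b ∈ H, ∀ c ∈ H, a + (b + c) = (a + b) + c

/-- The left nucleus of `G`. -/
def leftNucleus (G : Type u) [Gyrogroup G] : Set G :=
  {a : G | ∀ b c : G, a + (b + c) = (a + b) + c}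

/-- The middle nucleus of `G`. -/
def middleNucleus (G : Type u) [Gyrogroup G] : Set G :=
  {b : G | ∀ a c : G, a + (b + c) = (a + b) + c}

/-- The right nucleus of `G`. -/
def rightNucleus (G : Type u) [Gyrogroup G] : Set G :=
  {c : G | ∀ a b : G, a + (b + c) = (a + b) + c}

/-- `L(G)`: the set of left gyrotranslations of `G`, viewed as permutations of `G`.
A permutation `σ` is a left gyrotranslation when `σ x = a + x` for some fixed `a`. -/
def LSet (G : Type u) [Gyrogroup G] : Set (Equiv.Perm G) :=
  {σ : Equiv.Perm G | ∃ a : G, ∀ x : G, σ x = a + x}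

/-- `L(H)` for a subset `H ⊆ G`: the left gyrotranslations by elements of `H`. -/
def LSetOf [Gyrogroup G] (H : Set G) : Set (Equiv.Perm G) :=
  {σ : Equiv.Perm G | ∃ a ∈ H, ∀ x : G, σ x = a + x}

/-- The left multiplication group `LMlt(G)`: the subgroup of `Sym(G)` generated by
the left gyrotranslations. -/
def LMlt (G : Type u) [Gyrogroup G] : Subgroup (Equiv.Perm G) :=
  Subgroup.closure (LSet G)

/-- `L(G)'`: the set of products `L_{a₁} ∘ ⋯ ∘ L_{aₙ}` of left gyrotranslations whose
reversed product `L_{aₙ} ∘ ⋯ ∘ L_{a₁}` is the identity. -/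
def LPrime (G : Type u) [Gyrogroup G] : Set (Equiv.Perm G) :=
  {σ : Equiv.Perm G | ∃ l : List (Equiv.Perm G),
    (∀ τ ∈ l, τ ∈ LSet G) ∧ σ = l.prod ∧ l.reverse.prod = 1}

/-- `L(G)^# = ⋂_{a ∈ G} L_a ∘ L(G)`. -/
def LSharp (G : Type u) [Gyrogroup G] : Set (Equiv.Perm G) :=
  {σ : Equiv.Perm G | ∀ ρ ∈ LSet G, ∃ τ ∈ LSet G, σ = ρ * τ}

/-- The radical of `G`: elements whose left gyrotranslation lies in `L(G)'`. -/
def gyroRadical (G : Type u) [Gyrogroup G] : Set G :=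
  {a : G | ∃ σ ∈ LPrime G, ∀ x : G, σ x = a + x}

/-- `X` is a normal subgroup of the subgroup `Γ` (as a subset of the ambient group). -/
def IsNormalSubgroupIn {M : Type v} [Group M] (Γ : Subgroup M) (X : Set M) : Prop :=
  X ⊆ (Γ : Set M) ∧ (1 : M) ∈ X ∧ (∀ σ ∈ X, σ⁻¹ ∈ X) ∧
    (∀ σ ∈ X, ∀ τ ∈ X, σ * τ ∈ X) ∧ ∀ γ ∈ Γ, ∀ σ ∈ X, γ * σ * γ⁻¹ ∈ X

/-- The coaddition `a ⊞ b = a + gyr a (-b) b`. -/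
def gyroCoadd [Gyrogroup G] (a b : G) : G := a + gyr a (-b) b

/-- Natural-number multiples: `0 • a = 0`, `(m+1) • a = a + m • a`. -/
def gyroNsmul [Gyrogroup G] : ℕ → G → G
  | 0, _ => 0
  | n + 1, a => a + gyroNsmul n a

/-- The index `[G : H]`: the number of left cosets of `H` in `G`. -/
noncomputable def gyroIndex [Gyrogroup G] (H : Set G) : ℕ :=
  Set.ncard {S : Set G | ∃ a : G, S = lcoset a H}

namespace Gyrogroup

variable [Gyrogroup G]

lemma add_left_cancel_iff' (a : G) {b c : G} : a + b = a + c ↔ b = c := by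
  refine ⟨fun h => ?_, fun h => h ▸ rfl⟩
  have h' : -a + (a + b) = -a + (a + c) := by rw [h]
  rw [add_gyr_assoc', add_gyr_assoc', neg_add', zero_add', zero_add'] at h'
  exact (gyr (-a) a).injective h'

lemma gyr_zero_left (a c : G) : gyr 0 a c = c := by
  have h := add_gyr_assoc' 0 a c
  rw [zero_add', zero_add'] at h
  exact ((add_left_cancel_iff' a).1 h).symm

lemma neg_add_cancel_left' (a b : G) : -a + (a + b) = b := by
  rw [add_gyr_assoc', ← left_loop', neg_add', zero_add', gyr_zero_left]

lemma add_zero' (a : G) : a + 0 = a := by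
  rw [← add_left_cancel_iff' (-a), neg_add_cancel_left', neg_add']

lemma add_neg_cancel_left' (a b : G) : a + (-a + b) = b := by
  rw [← add_left_cancel_iff' (-a), neg_add_cancel_left']

lemma add_neg' (a : G) : a + -a = 0 := by
  simpa only [add_zero'] using add_neg_cancel_left' a 0

lemma gyr_map_zero (a b : G) : gyr a b 0 = 0 := by
  rw [← add_left_cancel_iff' (gyr a b 0), ← gyr_add', add_zero', add_zero']

lemma gyr_map_neg (a b c : G) : gyr a b (-c) = -gyr a b c := by
  rw [← add_left_cancel_iff' (gyr a b c), ← gyr_add', add_neg', add_neg', gyr_map_zero]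

lemma gyr_add_right_gyr (a b c : G) : gyr b (a + b) (gyr a b c) = c := by
  have h : gyr b (a + b) = gyr (-a) (a + b) := by
    rw [← left_loop' (-a) (a + b), neg_add_cancel_left']
  have h' := add_gyr_assoc' (-a) (a + b) (gyr a b c)
  rw [← add_gyr_assoc', neg_add_cancel_left', neg_add_cancel_left',
    add_left_cancel_iff'] at h'
  rw [h, ← h']

/-- The left Bol identity. -/
lemma left_bol (a b c : G) : a + (b + (a + c)) = (a + (b + a)) + c := by
  rw [add_gyr_assoc' b, add_gyr_assoc' a, gyr_add_right_gyr]

lemma exists_add_right_eq (a b : G) : ∃ y : G, y + b = a :=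
  ⟨-b + ((b + a) + -b), by
    rw [← left_bol, neg_add', add_zero', neg_add_cancel_left']⟩

lemma mem_rightNucleus_iff {c : G} : c ∈ rightNucleus G ↔ ∀ a b : G, gyr a b c = c := by
  refine forall₂_congr fun a b => ?_
  rw [add_gyr_assoc', add_left_cancel_iff']

theorem isSubgyrogroup_leftNucleus : IsSubgyrogroup (leftNucleus G) where
  nonempty := ⟨0, fun b c => by rw [zero_add', zero_add']⟩
  add_mem a ha b hb x y := by
    rw [← ha b (x + y), hb, ha, ha]
  neg_mem a ha b c := by
    rw [← add_left_cancel_iff' a, add_neg_cancel_left', ha, add_neg_cancel_left']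

theorem isSubgyrogroup_middleNucleus : IsSubgyrogroup (middleNucleus G) where
  nonempty := ⟨0, fun b c => by rw [zero_add', add_zero']⟩
  add_mem a ha b hb x y := by
    rw [← hb a y, ha, hb, ← ha x b]
  neg_mem b hb a c := by
    obtain ⟨y, rfl⟩ := exists_add_right_eq a b
    have h : ∀ d, (y + b) + (-b + d) = y + d := fun d => by
      rw [← hb, add_neg_cancel_left']
    have h' : (y + b) + -b = y := by simpa only [add_zero'] using h 0
    rw [h, h']

theorem isSubgyrogroup_rightNucleus : IsSubgyrogroup (rightNucleus G) where
  nonempty := ⟨0, fun a b => by rw [add_zero', add_zero']⟩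
  add_mem c hc d hd := by
    rw [mem_rightNucleus_iff] at *
    intro a b
    rw [gyr_add', hc, hd]
  neg_mem c hc := by
    rw [mem_rightNucleus_iff] at *
    intro a b
    rw [gyr_map_neg, hc]

lemma image_leftNucleus (f : G ≃ G) (hf : ∀ x y, f (x + y) = f x + f y) :
    f '' leftNucleus G = leftNucleus G := by
  ext x
  obtain ⟨x, rfl⟩ := f.surjective x
  rw [f.injective.mem_set_image]
  refine Iff.trans ?_ f.surjective.forall₂.symm
  exact forall₂_congr fun b c => by simp only [← hf, f.injective.eq_iff]

lemma image_middleNucleus (f : G ≃ G) (hf : ∀ x y, f (x + y) = f x + f y) :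
    f '' middleNucleus G = middleNucleus G := by
  ext x
  obtain ⟨x, rfl⟩ := f.surjective x
  rw [f.injective.mem_set_image]
  refine Iff.trans ?_ f.surjective.forall₂.symm
  exact forall₂_congr fun b c => by simp only [← hf, f.injective.eq_iff]

lemma image_rightNucleus (f : G ≃ G) (hf : ∀ x y, f (x + y) = f x + f y) :
    f '' rightNucleus G = rightNucleus G := by
  ext x
  obtain ⟨x, rfl⟩ := f.surjective x
  rw [f.injective.mem_set_image]
  refine Iff.trans ?_ f.surjective.forall₂.symm
  exact forall₂_congr fun b c => by simp only [← hf, f.injective.eq_iff]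

end Gyrogroup

/-- the left, middle, and right nuclei are L-subgyrogroups of `G`,
and each of them is a subgroup of `G`. -/
theorem nuclei_are_L_subgyrogroups_and_subgroups (G : Type u) [Gyrogroup G] :
    (IsLSubgyrogroup (leftNucleus G) ∧ IsLSubgyrogroup (middleNucleus G) ∧
      IsLSubgyrogroup (rightNucleus G)) ∧
    (IsSubgroupOfGyrogroup (leftNucleus G) ∧ IsSubgroupOfGyrogroup (middleNucleus G) ∧
      IsSubgroupOfGyrogroup (rightNucleus G)) := by
  exact
    ⟨⟨⟨isSubgyrogroup_leftNucleus, fun a h _ => image_leftNucleus _ (gyr_add' a h)⟩,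
      ⟨isSubgyrogroup_middleNucleus, fun a h _ => image_middleNucleus _ (gyr_add' a h)⟩,
      ⟨isSubgyrogroup_rightNucleus, fun a h _ => image_rightNucleus _ (gyr_add' a h)⟩⟩,
      ⟨isSubgyrogroup_leftNucleus, fun _ ha b _ c _ => ha b c⟩,
      ⟨isSubgyrogroup_middleNucleus, fun a _ _ hb c _ => hb a c⟩,
      ⟨isSubgyrogroup_rightNucleus, fun a _ b _ _ hc => hc a b⟩⟩
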